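/- The homomorphism determined by sending the class of Y[(i,m);(i,n);j] (for colors i ≠ j and distinct labels m, n) to ε_{mn}·(e_i ⊙ e_j), where ε_{mn} is the sign of n − m, and the class of Y[(i,m);(i,n);(i,l)] to ε_{mnl}·(e_i ⊙ e_i), where ε_{mnl} is the signature of the permutation sending (1,2,3) to (m,n,l), restricts to an isomorphism of abelian groups from A_{2,2}(n) ⊕ A_{2,1}(n) onto the second symmetric power S²H of H = ℤⁿ. -/

import Mathlib

/-! Common setup: the abelian group `A₂(n)` of Y-diagrams.

A generator ("Y-diagram") is modelled as a function `g : Fin 3 → Fin n × Fin 3`,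
assigning to each of the three (cyclically ordered) vertices a color in `{1,…,n}`
(modelled as `Fin n`) and a label in `{1,2,3}` (modelled as `Fin 3`).
Vertices whose color is shared must carry distinct labels (otherwise the
generator is declared to be `0`); labels of vertices with a unique color are
irrelevant, and only the relative order of labels of same-colored vertices
matters (the "relabeling" identification).  `A₂(n)` is the quotient of the free
abelian group on these generators by: the degenerate generators, the cyclic
identification, the relabeling identification, and the relations (AS), (AS2),
(W). -/

/-- A Y-diagram generator: three cyclically ordered vertices, each with a color
in `Fin n` and a label in `Fin 3`. -/
abbrev YGen (n : ℕ) := Fin 3 → Fin n × Fin 3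

namespace YDiag

variable {n : ℕ}

/-- The color of the `p`-th vertex. -/
def color (g : YGen n) (p : Fin 3) : Fin n := (g p).1

/-- The label of the `p`-th vertex. -/
def lab (g : YGen n) (p : Fin 3) : Fin 3 := (g p).2

/-- The set of defining relations for `A₂(n)` inside the free abelian group on
Y-diagram generators. -/
def rels (n : ℕ) : Set (FreeAbelianGroup (YGen n)) :=
  -- degenerate generators: two distinct vertices with the same color and label
  {x | ∃ g : YGen n, (∃ p q : Fin 3, p ≠ q ∧ g p = g q) ∧ x = FreeAbelianGroup.of g} ∪
  -- invariance under cyclic permutation of the vertices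
  {x | ∃ g : YGen n, x = FreeAbelianGroup.of g - FreeAbelianGroup.of (fun p => g (p + 1))} ∪
  -- relabeling: only the relative order of labels of same-colored vertices matters
  {x | ∃ g g' : YGen n, (∀ p, color g p = color g' p) ∧
      (∀ p q, color g p = color g q → (lab g p < lab g q ↔ lab g' p < lab g' q)) ∧
      x = FreeAbelianGroup.of g - FreeAbelianGroup.of g'} ∪
  -- (AS) : Y[i;j;k] = -Y[j;i;k] for pairwise distinct colors
  {x | ∃ g : YGen n, (color g 0 ≠ color g 1 ∧ color g 1 ≠ color g 2 ∧ color g 0 ≠ color g 2) ∧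
      x = FreeAbelianGroup.of g + FreeAbelianGroup.of (g ∘ Equiv.swap 0 1)} ∪
  -- (AS2) : Y[(i,m);(i,n);x] = -Y[(i,n);(i,m);x] for distinct labels m ≠ n
  {x | ∃ g : YGen n, color g 0 = color g 1 ∧ lab g 0 ≠ lab g 1 ∧
      x = FreeAbelianGroup.of g + FreeAbelianGroup.of (g ∘ Equiv.swap 0 1)} ∪
  -- (W) : Y[(i,m);(i,n);j] = Y[(j,m);(j,n);i] for distinct colors i ≠ j
  {x | ∃ (i j : Fin n) (m nn l l' : Fin 3), i ≠ j ∧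
      x = FreeAbelianGroup.of ![(i, m), (i, nn), (j, l)] -
          FreeAbelianGroup.of ![(j, m), (j, nn), (i, l')]}

/-- The abelian group `A₂(n)`. -/
abbrev A2 (n : ℕ) :=
  FreeAbelianGroup (YGen n) ⧸ AddSubgroup.closure (rels n)

/-- The class in `A₂(n)` of a Y-diagram generator. -/
def cls (g : YGen n) : A2 n := QuotientAddGroup.mk (FreeAbelianGroup.of g)

/-- The number of distinct colors used by the vertices of a Y-diagram. -/
def numColors (g : YGen n) : ℕ := (Finset.univ.image (color g)).card

/-- The subgroup `A_{2,k}(n)` of `A₂(n)` generated by the classes of Y-diagrams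
using exactly `k` distinct colors. -/
def A2k (n k : ℕ) : AddSubgroup (A2 n) :=
  AddSubgroup.closure {x | ∃ g : YGen n, numColors g = k ∧ x = cls g}

end YDiag

open TensorProduct

/-- The relations `x ⊗ y = y ⊗ x` defining the second symmetric power of `ℤⁿ`. -/
noncomputable def symRel (n : ℕ) : Submodule ℤ ((Fin n → ℤ) ⊗[ℤ] (Fin n → ℤ)) :=
  Submodule.span ℤ {z | ∃ x y : Fin n → ℤ, z = x ⊗ₜ y - y ⊗ₜ x}

/-- The second symmetric power `S²H` of `H = ℤⁿ`: the quotient of `H ⊗ H` by the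
relations `x ⊗ y = y ⊗ x`. -/
abbrev Sym2H (n : ℕ) := ((Fin n → ℤ) ⊗[ℤ] (Fin n → ℤ)) ⧸ symRel n

/-- The symmetric product `x ⊙ y ∈ S²H`. -/
noncomputable def sprod {n : ℕ} (x y : Fin n → ℤ) : Sym2H n :=
  Submodule.Quotient.mk (x ⊗ₜ[ℤ] y)

/-- `ε_{mn}`, the sign of `n - m` for distinct labels `m`, `n`. -/
def eps (m nn : Fin 3) : ℤ := if m < nn then 1 else -1

namespace YDiag

variable {n : ℕ}

/-- The sign of `b - a`, which is `0` when the labels agree. -/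
def labelSign (a b : Fin 3) : ℤ := if a < b then 1 else if b < a then -1 else 0

theorem labelSign_self (a : Fin 3) : labelSign a a = 0 := by simp [labelSign]

theorem labelSign_swap (a b : Fin 3) : labelSign b a = -labelSign a b := by
  revert a b; decide

theorem labelSign_eq_eps {a b : Fin 3} (h : a ≠ b) : labelSign a b = eps a b := by
  revert a b; decide

theorem labelSign_mul_eq_sign (σ : Equiv.Perm (Fin 3)) :
    labelSign (σ 0) (σ 1) * labelSign (σ 1) (σ 2) * labelSign (σ 0) (σ 2) =
      ((Equiv.Perm.sign σ : ℤˣ) : ℤ) := by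
  revert σ; decide

/-- The product `e_i ⊙ e_j` of standard basis vectors. -/
noncomputable def basisProd (i j : Fin n) : Sym2H n :=
  sprod (Pi.single i (1 : ℤ)) (Pi.single j (1 : ℤ))

theorem basisProd_comm (i j : Fin n) : basisProd i j = basisProd j i :=
  (Submodule.Quotient.eq _).2 (Submodule.subset_span ⟨_, _, rfl⟩)

/-- The value in `S²H` of a single Y-diagram. -/
noncomputable def genVal (g : YGen n) : Sym2H n :=
  if color g 0 = color g 1 then
    if color g 1 = color g 2 then
      (labelSign (lab g 0) (lab g 1) * labelSign (lab g 1) (lab g 2) *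
        labelSign (lab g 0) (lab g 2)) • basisProd (color g 0) (color g 0)
    else labelSign (lab g 0) (lab g 1) • basisProd (color g 0) (color g 2)
  else if color g 1 = color g 2 then
    labelSign (lab g 1) (lab g 2) • basisProd (color g 1) (color g 0)
  else if color g 2 = color g 0 then
    labelSign (lab g 2) (lab g 0) • basisProd (color g 2) (color g 1)
  else 0

theorem genVal_degenerate {g : YGen n} {p q : Fin 3} (hpq : p ≠ q) (h : g p = g q) :
    genVal g = 0 := by
  have hc : color g p = color g q := congrArg Prod.fst h
  have hl : lab g p = lab g q := congrArg Prod.snd h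
  fin_cases p <;> fin_cases q <;> simp only [genVal] <;> split_ifs <;>
    simp_all [labelSign_self]

theorem genVal_rotate (g : YGen n) : genVal (fun p => g (p + 1)) = genVal g := by
  have e : (1 : Fin 3) + 1 = 2 := rfl
  have e' : (2 : Fin 3) + 1 = 0 := rfl
  have hc (p : Fin 3) : color (fun p => g (p + 1)) p = color g (p + 1) := rfl
  have hl (p : Fin 3) : lab (fun p => g (p + 1)) p = lab g (p + 1) := rfl
  simp only [genVal, hc, hl, zero_add, e, e']
  rw [labelSign_swap (lab g 0) (lab g 2), labelSign_swap (lab g 0) (lab g 1)]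
  split_ifs <;> simp_all
  congr 1
  ring

theorem genVal_relabel {g g' : YGen n} (hc : ∀ p, color g p = color g' p)
    (hl : ∀ p q, color g p = color g q → (lab g p < lab g q ↔ lab g' p < lab g' q)) :
    genVal g = genVal g' := by
  have hs (p q : Fin 3) (h : color g p = color g q) :
      labelSign (lab g p) (lab g q) = labelSign (lab g' p) (lab g' q) := by
    simp only [labelSign, hl p q h, hl q p h.symm]
  simp only [genVal, ← hc]
  split_ifs with h₀ h₁ h₂ h₃
  · rw [hs 0 1 h₀, hs 1 2 h₁, hs 0 2 (h₀.trans h₁)]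
  · rw [hs 0 1 h₀]
  · rw [hs 1 2 h₂]
  · rw [hs 2 0 h₃]
  · rfl

theorem genVal_swap (g : YGen n) : genVal (g ∘ Equiv.swap 0 1) = -genVal g := by
  have h0 : Equiv.swap (0 : Fin 3) 1 0 = 1 := by decide
  have h1 : Equiv.swap (0 : Fin 3) 1 1 = 0 := by decide
  have h2 : Equiv.swap (0 : Fin 3) 1 2 = 2 := by decide
  have hc (p : Fin 3) : color (g ∘ Equiv.swap 0 1) p = color g (Equiv.swap 0 1 p) := rfl
  have hl (p : Fin 3) : lab (g ∘ Equiv.swap 0 1) p = lab g (Equiv.swap 0 1 p) := rfl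
  simp only [genVal, hc, hl, h0, h1, h2]
  rw [labelSign_swap (lab g 0) (lab g 1), labelSign_swap (lab g 1) (lab g 2),
    labelSign_swap (lab g 0) (lab g 2)]
  by_cases h₀ : color g 0 = color g 1 <;> by_cases h₁ : color g 1 = color g 2 <;>
    by_cases h₂ : color g 2 = color g 0 <;>
    simp_all [eq_comm (a := color g 1) (b := color g 0), eq_comm (a := color g 0) (b := color g 2)]
  · rw [mul_right_comm]
  · exact fun h => absurd h.symm h₁

theorem genVal_pair {i j : Fin n} (h : i ≠ j) (a b c : Fin 3) :
    genVal ![(i, a), (i, b), (j, c)] = labelSign a b • basisProd i j := by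
  simp [genVal, color, lab, h]

theorem genVal_triple (i : Fin n) (a b c : Fin 3) :
    genVal ![(i, a), (i, b), (i, c)] =
      (labelSign a b * labelSign b c * labelSign a c) • basisProd i i := by
  simp [genVal, color, lab]

/-- The homomorphism `A₂(n) → S²H`. -/
noncomputable def toSym (n : ℕ) : A2 n →+ Sym2H n :=
  QuotientAddGroup.lift _ (FreeAbelianGroup.lift genVal) <| by
    rw [AddSubgroup.closure_le]
    rintro x (((((⟨g, ⟨p, q, hpq, h⟩, rfl⟩ | ⟨g, rfl⟩) | ⟨g, g', hc, hl, rfl⟩) |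
      ⟨g, -, rfl⟩) | ⟨g, -, -, rfl⟩) | ⟨i, j, a, b, c, c', h, rfl⟩) <;>
      simp only [SetLike.mem_coe, AddMonoidHom.mem_ker, map_sub, map_add,
        FreeAbelianGroup.lift_apply_of]
    · exact genVal_degenerate hpq h
    · rw [genVal_rotate, sub_self]
    · rw [genVal_relabel hc hl, sub_self]
    · rw [genVal_swap, add_neg_cancel]
    · rw [genVal_swap, add_neg_cancel]
    · rw [genVal_pair h, genVal_pair h.symm, basisProd_comm, sub_self]

theorem toSym_cls (g : YGen n) : toSym n (cls g) = genVal g :=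
  FreeAbelianGroup.lift_apply_of genVal g

theorem cls_eq_of_sub_mem {g g' : YGen n}
    (h : FreeAbelianGroup.of g - FreeAbelianGroup.of g' ∈ rels n) : cls g = cls g' :=
  (QuotientAddGroup.eq_iff_sub_mem).2 (AddSubgroup.subset_closure h)

theorem cls_degenerate {g : YGen n} {p q : Fin 3} (hpq : p ≠ q) (h : g p = g q) :
    cls g = 0 :=
  (QuotientAddGroup.eq_zero_iff _).2 <| AddSubgroup.subset_closure <|
    .inl <| .inl <| .inl <| .inl <| .inl ⟨g, ⟨p, q, hpq, h⟩, rfl⟩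

theorem cls_rotate (g : YGen n) : cls g = cls (fun p => g (p + 1)) :=
  cls_eq_of_sub_mem <| .inl <| .inl <| .inl <| .inl <| .inr ⟨g, rfl⟩

theorem cls_relabel {g g' : YGen n} (hc : ∀ p, color g p = color g' p)
    (hl : ∀ p q, color g p = color g q → (lab g p < lab g q ↔ lab g' p < lab g' q)) :
    cls g = cls g' :=
  cls_eq_of_sub_mem <| .inl <| .inl <| .inl <| .inr ⟨g, g', hc, hl, rfl⟩

theorem cls_swap {g : YGen n} (hc : color g 0 = color g 1) (hl : lab g 0 ≠ lab g 1) :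
    cls g = -cls (g ∘ Equiv.swap 0 1) :=
  eq_neg_of_add_eq_zero_left <| (QuotientAddGroup.eq_zero_iff _).2 <|
    AddSubgroup.subset_closure <| .inl <| .inr ⟨g, hc, hl, rfl⟩

theorem cls_rotate_vec (a b c : Fin n × Fin 3) : cls ![a, b, c] = cls ![b, c, a] := by
  rw [cls_rotate]
  congr 1
  ext p : 1
  fin_cases p <;> rfl

theorem cls_swap_vec (i : Fin n) {a b : Fin 3} (h : a ≠ b) (x : Fin n × Fin 3) :
    cls ![(i, a), (i, b), x] = -cls ![(i, b), (i, a), x] := by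
  rw [cls_swap (g := ![(i, a), (i, b), x]) rfl h]
  congr 2
  ext p : 1
  fin_cases p <;> rfl

/-- The class `Y[(i,1);(i,2);(j,3)]`. -/
def stdCls (i j : Fin n) : A2 n := cls ![(i, 0), (i, 1), (j, 2)]

theorem stdCls_comm (i j : Fin n) : stdCls i j = stdCls j i := by
  rcases eq_or_ne i j with rfl | h
  · rfl
  · exact cls_eq_of_sub_mem <| .inr ⟨i, j, 0, 1, 2, 2, h, rfl⟩

theorem cls_pair {i j : Fin n} (h : i ≠ j) (a b c : Fin 3) :
    cls ![(i, a), (i, b), (j, c)] = labelSign a b • stdCls i j := by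
  have key {a b : Fin 3} (hab : a < b) : cls ![(i, a), (i, b), (j, c)] = stdCls i j := by
    refine cls_relabel (fun p => ?_) (fun p q => ?_)
    · fin_cases p <;> rfl
    · fin_cases p <;> fin_cases q <;> simp [color, lab, h, h.symm, hab, hab.le]
  rcases lt_trichotomy a b with hab | rfl | hab
  · simp [key hab, labelSign, hab]
  · rw [cls_degenerate (p := 0) (q := 1) (by decide) rfl, labelSign_self, zero_smul]
  · rw [cls_swap_vec i hab.ne', key hab]
    simp [labelSign, hab, hab.le]

theorem cls_triple (i : Fin n) (a b c : Fin 3) :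
    cls ![(i, a), (i, b), (i, c)] =
      (labelSign a b * labelSign b c * labelSign a c) • stdCls i i := by
  by_cases hab : a = b
  · subst hab
    rw [cls_degenerate (p := 0) (q := 1) (by decide) rfl]
    simp [labelSign_self]
  by_cases hbc : b = c
  · subst hbc
    rw [cls_degenerate (p := 1) (q := 2) (by decide) rfl]
    simp [labelSign_self]
  by_cases hac : a = c
  · subst hac
    rw [cls_degenerate (p := 0) (q := 2) (by decide) rfl]
    simp [labelSign_self]
  have h120 : cls ![(i, 1), (i, 2), (i, 0)] = stdCls i i :=
    (cls_rotate_vec _ _ _).symm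
  have h201 : cls ![(i, 2), (i, 0), (i, 1)] = stdCls i i := cls_rotate_vec _ _ _
  have h102 : cls ![(i, 1), (i, 0), (i, 2)] = -stdCls i i :=
    cls_swap_vec i (by decide) _
  have h210 : cls ![(i, 2), (i, 1), (i, 0)] = -stdCls i i := by
    rw [cls_swap_vec i (by decide), h120]
  have h021 : cls ![(i, 0), (i, 2), (i, 1)] = -stdCls i i := by
    rw [cls_swap_vec i (by decide), h201]
  fin_cases a <;> fin_cases b <;> fin_cases c <;>
    first
    | exact absurd rfl hab
    | exact absurd rfl hbc
    | exact absurd rfl hac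
    | simp [labelSign, h120, h201, h102, h210, h021]
  rfl

/-- The bilinear form on `ℤⁿ` sending `(e_i, e_j)` to `Y[(i,1);(i,2);(j,3)]`. -/
noncomputable def stdForm (n : ℕ) : (Fin n → ℤ) →ₗ[ℤ] (Fin n → ℤ) →ₗ[ℤ] A2 n :=
  (Pi.basisFun ℤ (Fin n)).constr ℤ fun i => (Pi.basisFun ℤ (Fin n)).constr ℤ (stdCls i)

theorem stdForm_single (i j : Fin n) :
    stdForm n (Pi.single i 1) (Pi.single j 1) = stdCls i j := by
  simp only [stdForm, ← Pi.basisFun_apply ℤ (Fin n), Module.Basis.constr_basis]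

theorem stdForm_comm (x y : Fin n → ℤ) : stdForm n x y = stdForm n y x := by
  have h : stdForm n = (stdForm n).flip := by
    refine (Pi.basisFun ℤ (Fin n)).ext fun i => (Pi.basisFun ℤ (Fin n)).ext fun j => ?_
    simp only [LinearMap.flip_apply, Pi.basisFun_apply, stdForm_single]
    exact stdCls_comm i j
  exact LinearMap.congr_fun₂ h x y

/-- The homomorphism `S²H → A₂(n)` sending `e_i ⊙ e_j` to `Y[(i,1);(i,2);(j,3)]`. -/
noncomputable def ofSym (n : ℕ) : Sym2H n →ₗ[ℤ] A2 n :=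
  (symRel n).liftQ (TensorProduct.lift (stdForm n)).toAddMonoidHom.toIntLinearMap <| by
    refine Submodule.span_le.2 ?_
    rintro _ ⟨x, y, rfl⟩
    refine (map_sub (TensorProduct.lift (stdForm n)) _ _).trans ?_
    rw [TensorProduct.lift.tmul, TensorProduct.lift.tmul, stdForm_comm, sub_self]

theorem ofSym_basisProd (i j : Fin n) : ofSym n (basisProd i j) = stdCls i j :=
  (TensorProduct.lift.tmul _ _).trans (stdForm_single i j)

theorem toSym_stdCls (i j : Fin n) : toSym n (stdCls i j) = basisProd i j := by
  rw [stdCls, toSym_cls]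
  rcases eq_or_ne i j with rfl | h
  · simp [genVal_triple, labelSign]
  · simp [genVal_pair h, labelSign]

theorem eq_top_of_basisProd_mem {S : AddSubgroup (Sym2H n)}
    (h : ∀ i j, basisProd i j ∈ S) : S = ⊤ := by
  refine (AddSubgroup.eq_top_iff' S).2 fun x => ?_
  obtain ⟨t, rfl⟩ := Submodule.Quotient.mk_surjective _ x
  let q : (Fin n → ℤ) ⊗[ℤ] (Fin n → ℤ) →+ Sym2H n := (symRel n).mkQ.toAddMonoidHom
  change q t ∈ S
  have ht := ((Pi.basisFun ℤ (Fin n)).tensorProduct (Pi.basisFun ℤ (Fin n))).mem_span t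
  induction ht using Submodule.span_induction with
  | mem t ht =>
    obtain ⟨p, rfl⟩ := ht
    rw [Module.Basis.tensorProduct_apply', Pi.basisFun_apply, Pi.basisFun_apply]
    exact h p.1 p.2
  | zero => rw [map_zero]; exact zero_mem _
  | add x y _ _ hx hy => rw [map_add]; exact add_mem hx hy
  | smul a x _ hx => rw [map_zsmul]; exact zsmul_mem hx a

theorem toSym_ofSym (x : Sym2H n) : toSym n (ofSym n x) = x := by
  have h : ((toSym n).comp (ofSym n).toAddMonoidHom).eqLocus (AddMonoidHom.id _) = ⊤ :=
    eq_top_of_basisProd_mem fun i j =>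
      (congrArg (toSym n) (ofSym_basisProd i j)).trans (toSym_stdCls i j)
  exact (AddSubgroup.eq_top_iff' _).1 h x

theorem stdCls_mem (i j : Fin n) : stdCls i j ∈ A2k n 2 ⊔ A2k n 1 := by
  rcases eq_or_ne i j with rfl | h
  · refine AddSubgroup.mem_sup_right (AddSubgroup.subset_closure ⟨_, ?_, rfl⟩)
    have : Finset.univ.image (color ![(i, 0), (i, 1), (i, 2)]) = {i} := by
      ext c
      simp [color, Fin.exists_fin_succ, eq_comm]
    rw [numColors, this, Finset.card_singleton]
  · refine AddSubgroup.mem_sup_left (AddSubgroup.subset_closure ⟨_, ?_, rfl⟩)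
    have : Finset.univ.image (color ![(i, 0), (i, 1), (j, 2)]) = {i, j} := by
      ext c
      simp [color, Fin.exists_fin_succ, eq_comm]
    rw [numColors, this, Finset.card_pair h]

theorem ofSym_mem (x : Sym2H n) : ofSym n x ∈ A2k n 2 ⊔ A2k n 1 := by
  have h : (A2k n 2 ⊔ A2k n 1).comap (ofSym n).toAddMonoidHom = ⊤ :=
    eq_top_of_basisProd_mem fun i j => by
      change ofSym n (basisProd i j) ∈ A2k n 2 ⊔ A2k n 1
      exact (ofSym_basisProd i j).symm ▸ stdCls_mem i j
  exact (AddSubgroup.eq_top_iff' _).1 h x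

theorem ofSym_toSym_pair (i j : Fin n) (a b c : Fin 3) :
    ofSym n (toSym n (cls ![(i, a), (i, b), (j, c)])) = cls ![(i, a), (i, b), (j, c)] := by
  rw [toSym_cls]
  rcases eq_or_ne i j with rfl | h
  · rw [genVal_triple, cls_triple, map_smul, ofSym_basisProd]
  · rw [genVal_pair h, cls_pair h, map_smul, ofSym_basisProd]

theorem exists_color_eq {g : YGen n} (h : numColors g ≠ 3) :
    color g 0 = color g 1 ∨ color g 1 = color g 2 ∨ color g 2 = color g 0 := by
  contrapose! h
  obtain ⟨h₀, h₁, h₂⟩ := h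
  have hinj : Function.Injective (color g) := by
    intro p q hpq
    fin_cases p <;> fin_cases q <;> simp_all
  rw [numColors, Finset.card_image_of_injective _ hinj, Finset.card_univ, Fintype.card_fin]

theorem ofSym_toSym_cls {g : YGen n} (h : numColors g ≠ 3) :
    ofSym n (toSym n (cls g)) = cls g := by
  have hg : g = ![(color g 0, lab g 0), (color g 1, lab g 1), (color g 2, lab g 2)] := by
    ext p : 1
    fin_cases p <;> rfl
  rw [hg]
  rcases exists_color_eq h with h | h | h
  · rw [h]
    exact ofSym_toSym_pair _ _ _ _ _
  · rw [cls_rotate_vec, h]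
    exact ofSym_toSym_pair _ _ _ _ _
  · rw [← cls_rotate_vec, h]
    exact ofSym_toSym_pair _ _ _ _ _

theorem ofSym_toSym {x : A2 n} (hx : x ∈ A2k n 2 ⊔ A2k n 1) :
    ofSym n (toSym n x) = x := by
  have hle : A2k n 2 ⊔ A2k n 1 ≤
      ((ofSym n).toAddMonoidHom.comp (toSym n)).eqLocus (AddMonoidHom.id _) := by
    refine sup_le ?_ ?_ <;> refine (AddSubgroup.closure_le _).2 ?_ <;> rintro _ ⟨g, hg, rfl⟩ <;>
      exact ofSym_toSym_cls (by omega)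
  exact hle hx

end YDiag

open YDiag in
/-- The homomorphism sending the class of `Y[(i,m);(i,n);j]` (`i ≠ j`, `m ≠ n`) to
`ε_{mn}·(e_i ⊙ e_j)` and the class of `Y[(i,m);(i,n);(i,l)]` (where `(m,n,l)` is a
permutation `σ` of the labels) to `sgn(σ)·(e_i ⊙ e_i)` restricts to an isomorphism
of abelian groups from `A_{2,2}(n) ⊕ A_{2,1}(n)` onto `S²H`, `H = ℤⁿ`. -/
theorem A22_A21_iso_symmetricPower (n : ℕ) (hn : 1 ≤ n) :
    ∃ f : A2 n →+ Sym2H n,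
      (∀ (i j : Fin n) (m nn l : Fin 3), i ≠ j → m ≠ nn →
        f (cls ![(i, m), (i, nn), (j, l)]) =
          eps m nn • sprod (Pi.single i (1 : ℤ)) (Pi.single j (1 : ℤ))) ∧
      (∀ (i : Fin n) (σ : Equiv.Perm (Fin 3)),
        f (cls ![(i, σ 0), (i, σ 1), (i, σ 2)]) =
          ((Equiv.Perm.sign σ : ℤˣ) : ℤ) •
            sprod (Pi.single i (1 : ℤ)) (Pi.single i (1 : ℤ))) ∧
      Set.BijOn f ((A2k n 2 ⊔ A2k n 1 : AddSubgroup (A2 n)) : Set (A2 n)) Set.univ := by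
  refine ⟨toSym n, fun i j m nn l h hm => ?_, fun i σ => ?_, ?_⟩
  · rw [toSym_cls, genVal_pair h, labelSign_eq_eps hm]
    rfl
  · rw [toSym_cls, genVal_triple, labelSign_mul_eq_sign]
    rfl
  · exact Set.InvOn.bijOn (f' := ofSym n) ⟨fun x hx => ofSym_toSym hx, fun x _ => toSym_ofSym x⟩
      (Set.mapsTo_univ _ _) fun x _ => ofSym_mem x
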